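/- arXiv:2506.16188 — 2 statements merged into one kernel-verified Lean document; each statement's English description precedes it below -/
import Mathlib

section
/- Let C be a triangulated category, n ≥ 1, let (𝒳, 𝒴) be an n-cotorsion pair in C, and let 𝒟 ⊆ I(𝒳) be a functorially finite subcategory satisfying ⋂_{k=1}^{n} {}^{⊥_k}𝒟 = ⋂_{k=1}^{n} 𝒟^{⊥_k}. Then (μ^{-1}_𝒟(𝒳), μ^{-1}_𝒟(𝒴)) is an n-cotorsion pair in C, and its core satisfies I(μ^{-1}_𝒟(𝒳)) = μ^{-1}_𝒟(I(𝒳)). -/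
open CategoryTheory Category Limits Pretriangulated ZeroObject

variable {C : Type*} [Category C] [Preadditive C] [HasZeroObject C]
  [HasShift C ℤ] [∀ n : ℤ, (shiftFunctor C n).Additive] [Pretriangulated C]
  [IsTriangulated C]

/-- `f : A ⟶ B` is a right `X`-approximation of `B`. -/
def IsRightApprox (X : Set C) {A B : C} (f : A ⟶ B) : Prop :=
  A ∈ X ∧ ∀ A' : C, A' ∈ X → ∀ g : A' ⟶ B, ∃ h : A' ⟶ A, h ≫ f = g

/-- `f : A ⟶ B` is a left `X`-approximation of `A`. -/
def IsLeftApprox (X : Set C) {A B : C} (f : A ⟶ B) : Prop :=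
  B ∈ X ∧ ∀ B' : C, B' ∈ X → ∀ g : A ⟶ B', ∃ h : B ⟶ B', f ≫ h = g

/-- `X` is contravariantly finite: every object admits a right `X`-approximation. -/
def ContravariantlyFinite (X : Set C) : Prop :=
  ∀ Z : C, ∃ (A : C) (f : A ⟶ Z), IsRightApprox X f

/-- `X` is covariantly finite: every object admits a left `X`-approximation. -/
def CovariantlyFinite (X : Set C) : Prop :=
  ∀ Z : C, ∃ (B : C) (f : Z ⟶ B), IsLeftApprox X f

/-- `D` is `(n+1)`-rigid: `Hom(D, Σ^k D') = 0` for all `D, D' ∈ D` and `1 ≤ k ≤ n`. -/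
def IsRigid (n : ℕ) (D : Set C) : Prop :=
  ∀ d ∈ D, ∀ d' ∈ D, ∀ k : ℕ, 1 ≤ k → k ≤ n → ∀ f : d ⟶ d'⟦(k : ℤ)⟧, f = 0

/-- `⋂_{k=1}^{n} {}^{⊥_k} D`. -/
def leftPerpInter (D : Set C) (n : ℕ) : Set C :=
  {M : C | ∀ k : ℕ, 1 ≤ k → k ≤ n → ∀ d ∈ D, ∀ f : M ⟶ d⟦(k : ℤ)⟧, f = 0}

/-- `⋂_{k=1}^{n} D^{⊥_k}`. -/
def rightPerpInter (D : Set C) (n : ℕ) : Set C :=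
  {N : C | ∀ k : ℕ, 1 ≤ k → k ≤ n → ∀ d ∈ D, ∀ f : d ⟶ N⟦(k : ℤ)⟧, f = 0}

/-- `(U, V)` is an `n`-cotorsion pair: `U = ⋂_{k=1}^n {}^{⊥ₖ}V`,
`V = ⋂_{k=1}^n U^{⊥ₖ}`, `U` is contravariantly finite and `V` is covariantly finite. -/
def NCotorsionPair (n : ℕ) (U V : Set C) : Prop :=
  U = {M : C | ∀ k : ℕ, 1 ≤ k → k ≤ n → ∀ v ∈ V, ∀ f : M ⟶ v⟦(k : ℤ)⟧, f = 0} ∧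
  V = {N : C | ∀ k : ℕ, 1 ≤ k → k ≤ n → ∀ u ∈ U, ∀ f : u ⟶ N⟦(k : ℤ)⟧, f = 0} ∧
  ContravariantlyFinite U ∧ CovariantlyFinite V

/-- Forward `D`-mutation: objects `M` admitting a distinguished triangle
`A ⟶ d ⟶ M ⟶ ΣA` with `A ∈ X`, `d ∈ D` and `A ⟶ d` a left `D`-approximation. -/
def forwardMut (D X : Set C) : Set C :=
  {M : C | ∃ (A d : C) (_ : A ∈ X) (_ : d ∈ D) (f : A ⟶ d) (g : d ⟶ M)
    (h : M ⟶ A⟦(1 : ℤ)⟧), (Triangle.mk f g h ∈ distTriang C) ∧ IsLeftApprox D f}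

/-- Backward `D`-mutation: objects `M` admitting a distinguished triangle
`M ⟶ d ⟶ B ⟶ ΣM` with `B ∈ Y`, `d ∈ D` and `d ⟶ B` a right `D`-approximation. -/
def backwardMut (D Y : Set C) : Set C :=
  {M : C | ∃ (B d : C) (_ : B ∈ Y) (_ : d ∈ D) (f : M ⟶ d) (g : d ⟶ B)
    (h : B ⟶ M⟦(1 : ℤ)⟧), (Triangle.mk f g h ∈ distTriang C) ∧ IsRightApprox D g}


set_option linter.unusedSectionVars false

/-- vanishing of `Hom(A, Σ^k B)` -/
def HV (A B : C) (k : ℤ) : Prop := ∀ f : A ⟶ B⟦k⟧, f = 0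

lemma hv_of_shift {A B : C} {a b c k : ℤ} (hk : b + c = k + a) (h : HV A B k)
    (f : A⟦a⟧ ⟶ B⟦b⟧⟦c⟧) : f = 0 := by
  let e : B⟦b⟧⟦c⟧ ≅ B⟦k⟧⟦a⟧ :=
    ((shiftFunctorAdd' C b c (k + a) hk).app B).symm ≪≫ ((shiftFunctorAdd' C k a (k + a) rfl).app B)
  obtain ⟨g, hg⟩ := (shiftFunctor C a).map_surjective (f ≫ e.hom)
  rw [h g, Functor.map_zero] at hg
  rw [← cancel_mono e.hom, ← hg, zero_comp]

lemma hv_of_shift₁ {A B : C} {a b k : ℤ} (hk : b = k + a) (h : HV A B k)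
    (f : A⟦a⟧ ⟶ B⟦b⟧) : f = 0 := by
  let e : B⟦b⟧ ≅ B⟦k⟧⟦a⟧ := (shiftFunctorAdd' C k a b hk.symm).app B
  obtain ⟨g, hg⟩ := (shiftFunctor C a).map_surjective (f ≫ e.hom)
  rw [h g, Functor.map_zero] at hg
  rw [← cancel_mono e.hom, ← hg, zero_comp]

lemma hv_of_shift₂ {A B : C} {b c k : ℤ} (hk : b + c = k) (h : HV A B k)
    (f : A ⟶ B⟦b⟧⟦c⟧) : f = 0 := by
  let e : B⟦b⟧⟦c⟧ ≅ B⟦k⟧ := ((shiftFunctorAdd' C b c k hk).app B).symm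
  rw [← cancel_mono e.hom, h (f ≫ e.hom), zero_comp]

lemma hv_to_shift {A B : C} {a b c k : ℤ} (hk : b + c = k + a)
    (h : ∀ f : A⟦a⟧ ⟶ B⟦b⟧⟦c⟧, f = 0) : HV A B k := by
  intro g
  let e : B⟦b⟧⟦c⟧ ≅ B⟦k⟧⟦a⟧ :=
    ((shiftFunctorAdd' C b c (k + a) hk).app B).symm ≪≫ ((shiftFunctorAdd' C k a (k + a) rfl).app B)
  have := h (g⟦a⟧' ≫ e.inv)
  apply (shiftFunctor C a).map_injective
  rw [← cancel_mono e.inv, this, Functor.map_zero, zero_comp]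

lemma hv_to_shift₂ {A B : C} {b c k : ℤ} (hk : b + c = k)
    (h : ∀ f : A ⟶ B⟦b⟧⟦c⟧, f = 0) : HV A B k := by
  intro g
  let e : B⟦b⟧⟦c⟧ ≅ B⟦k⟧ := ((shiftFunctorAdd' C b c k hk).app B).symm
  rw [← cancel_mono e.inv, h (g ≫ e.inv), zero_comp]

lemma unshift_map {W P : C} (k : ℤ) (φ : W ⟶ P⟦k⟧) :
    ∃ φ0 : W⟦-k⟧ ⟶ P, φ = (shiftNegShift W k).inv ≫ φ0⟦k⟧' := by
  obtain ⟨g, hg⟩ := (shiftFunctor C k).map_surjective ((shiftNegShift W k).hom ≫ φ)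
  exact ⟨g, by rw [hg, Iso.inv_hom_id_assoc]⟩

lemma unshift_zero {W P Q : C} (k : ℤ) (φ0 : W⟦-k⟧ ⟶ P) (u : P ⟶ Q)
    (h : ((shiftNegShift W k).inv ≫ φ0⟦k⟧') ≫ u⟦k⟧' = 0) : φ0 ≫ u = 0 := by
  apply (shiftFunctor C k).map_injective
  rw [assoc, ← Functor.map_comp, ← cancel_epi (shiftNegShift W k).hom, Iso.hom_inv_id_assoc,
    comp_zero] at h
  rw [h, Functor.map_zero]

section tri
set_option linter.unusedSectionVars false
variable {A B M : C} {f : A ⟶ B} {g : B ⟶ M} {h : M ⟶ A⟦(1 : ℤ)⟧}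

lemma co₂ (T : Triangle.mk f g h ∈ distTriang C) {W : C} (φ : W ⟶ B)
    (hφ : φ ≫ g = 0) : ∃ ψ : W ⟶ A, φ = ψ ≫ f := Triangle.coyoneda_exact₂ _ T φ hφ
lemma co₃ (T : Triangle.mk f g h ∈ distTriang C) {W : C} (φ : W ⟶ M)
    (hφ : φ ≫ h = 0) : ∃ ψ : W ⟶ B, φ = ψ ≫ g := Triangle.coyoneda_exact₃ _ T φ hφ
lemma co₁ (T : Triangle.mk f g h ∈ distTriang C) {W : C} (φ : W ⟶ A⟦(1 : ℤ)⟧)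
    (hφ : φ ≫ f⟦(1 : ℤ)⟧' = 0) : ∃ ψ : W ⟶ M, φ = ψ ≫ h := Triangle.coyoneda_exact₁ _ T φ hφ
lemma yo₂ (T : Triangle.mk f g h ∈ distTriang C) {W : C} (φ : B ⟶ W)
    (hφ : f ≫ φ = 0) : ∃ ψ : M ⟶ W, φ = g ≫ ψ := Triangle.yoneda_exact₂ _ T φ hφ

lemma sh_ex₂ (T : Triangle.mk f g h ∈ distTriang C) {W : C} (k : ℤ) (φ : W ⟶ B⟦k⟧)
    (hφ : φ ≫ g⟦k⟧' = 0) : ∃ ψ : W ⟶ A⟦k⟧, φ = ψ ≫ f⟦k⟧' := by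
  obtain ⟨φ0, rfl⟩ := unshift_map k φ
  obtain ⟨ψ, hψ⟩ := co₂ T φ0 (unshift_zero k _ _ hφ)
  exact ⟨(shiftNegShift W k).inv ≫ ψ⟦k⟧', by rw [hψ, Functor.map_comp, assoc]⟩

lemma sh_ex₃ (T : Triangle.mk f g h ∈ distTriang C) {W : C} (k : ℤ) (φ : W ⟶ M⟦k⟧)
    (hφ : φ ≫ h⟦k⟧' = 0) : ∃ ψ : W ⟶ B⟦k⟧, φ = ψ ≫ g⟦k⟧' := by
  obtain ⟨φ0, rfl⟩ := unshift_map k φ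
  obtain ⟨ψ, hψ⟩ := co₃ T φ0 (unshift_zero k _ _ hφ)
  exact ⟨(shiftNegShift W k).inv ≫ ψ⟦k⟧', by rw [hψ, Functor.map_comp, assoc]⟩

lemma sh_ex₁ (T : Triangle.mk f g h ∈ distTriang C) {W : C} (k : ℤ) (φ : W ⟶ A⟦(1 : ℤ)⟧⟦k⟧)
    (hφ : φ ≫ f⟦(1 : ℤ)⟧'⟦k⟧' = 0) : ∃ ψ : W ⟶ M⟦k⟧, φ = ψ ≫ h⟦k⟧' := by
  obtain ⟨φ0, rfl⟩ := unshift_map k φ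
  obtain ⟨ψ, hψ⟩ := co₁ T φ0 (unshift_zero k _ _ hφ)
  exact ⟨(shiftNegShift W k).inv ≫ ψ⟦k⟧', by rw [hψ, Functor.map_comp, assoc]⟩

lemma yo₃ (T : Triangle.mk f g h ∈ distTriang C) {W : C} (φ : M ⟶ W)
    (hφ : g ≫ φ = 0) : ∃ ψ : A⟦(1 : ℤ)⟧ ⟶ W, φ = h ≫ ψ :=
  Triangle.yoneda_exact₃ _ T φ hφ

lemma yo₄ (T : Triangle.mk f g h ∈ distTriang C) {W : C} (φ : A⟦(1 : ℤ)⟧ ⟶ W)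
    (hφ : h ≫ φ = 0) : ∃ ψ : B⟦(1 : ℤ)⟧ ⟶ W, φ = f⟦(1 : ℤ)⟧' ≫ ψ := by
  obtain ⟨ψ, hψ⟩ : ∃ ψ : B⟦(1 : ℤ)⟧ ⟶ W, φ = (-f⟦(1 : ℤ)⟧') ≫ ψ :=
    Triangle.yoneda_exact₃ _ (rot_of_distTriang _ T) φ hφ
  exact ⟨-ψ, by rw [hψ]; simp⟩

lemma yo₁ (T : Triangle.mk f g h ∈ distTriang C) {W : C} (φ : A ⟶ W)
    (hφ : h ≫ φ⟦(1 : ℤ)⟧' = 0) : ∃ ψ : B ⟶ W, φ = f ≫ ψ := by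
  obtain ⟨ψ, hψ⟩ := yo₄ T _ hφ
  obtain ⟨u, rfl⟩ := (shiftFunctor C (1 : ℤ)).map_surjective ψ
  exact ⟨u, (shiftFunctor C (1 : ℤ)).map_injective (by rw [hψ, Functor.map_comp])⟩

lemma tri_z₁ (T : Triangle.mk f g h ∈ distTriang C) : f ≫ g = 0 :=
  comp_distTriang_mor_zero₁₂ _ T
lemma tri_z₂ (T : Triangle.mk f g h ∈ distTriang C) : g ≫ h = 0 :=
  comp_distTriang_mor_zero₂₃ _ T
lemma tri_z₃ (T : Triangle.mk f g h ∈ distTriang C) : h ≫ f⟦(1 : ℤ)⟧' = 0 :=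
  comp_distTriang_mor_zero₃₁ _ T

variable {A' B' M' : C} {f' : A' ⟶ B'} {g' : B' ⟶ M'} {h' : M' ⟶ A'⟦(1 : ℤ)⟧}

lemma tr3 (T : Triangle.mk f g h ∈ distTriang C) (T' : Triangle.mk f' g' h' ∈ distTriang C)
    (a : A ⟶ A') (b : B ⟶ B') (e : f ≫ b = a ≫ f') :
    ∃ c : M ⟶ M', g ≫ c = b ≫ g' ∧ h ≫ a⟦(1 : ℤ)⟧' = c ≫ h' :=
  complete_distinguished_triangle_morphism _ _ T T' a b e

lemma tr3₁ (T : Triangle.mk f g h ∈ distTriang C) (T' : Triangle.mk f' g' h' ∈ distTriang C)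
    (b : B ⟶ B') (c : M ⟶ M') (e : g ≫ c = b ≫ g') :
    ∃ a : A ⟶ A', f ≫ b = a ≫ f' ∧ h ≫ a⟦(1 : ℤ)⟧' = c ≫ h' :=
  complete_distinguished_triangle_morphism₁ _ _ T T' b c e

lemma hv_mut (T : Triangle.mk f g h ∈ distTriang C) (T' : Triangle.mk f' g' h' ∈ distTriang C)
    {k : ℤ} (h1 : HV B M' k) (h2 : HV A A' k) (h3 : HV M B' k) : HV M M' k := by
  intro α
  obtain ⟨γ, rfl⟩ := yo₃ T α (h1 _)
  have : γ ≫ h'⟦k⟧' = 0 := hv_of_shift (by ring) h2 _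
  obtain ⟨δ, hδ⟩ := sh_ex₃ T' k (h ≫ γ) (by rw [assoc, this, comp_zero])
  rw [hδ, h3 δ, zero_comp]

lemma hv_unmut (T : Triangle.mk f g h ∈ distTriang C) (T' : Triangle.mk f' g' h' ∈ distTriang C)
    {k : ℤ} (h1 : HV B A' k) (h2 : HV M M' k) (h3 : HV A B' k) : HV A A' k := by
  refine hv_to_shift (a := 1) (b := 1) (c := k) (by ring) (fun β => ?_)
  have z : β ≫ f'⟦(1 : ℤ)⟧'⟦k⟧' = 0 := hv_of_shift (by ring) h3 _
  obtain ⟨γ, hγ⟩ := sh_ex₁ T' k (h ≫ β) (by rw [assoc, z, comp_zero])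
  obtain ⟨δ, hδ⟩ := yo₄ T β (by rw [hγ, h2 γ, zero_comp])
  rw [hδ, hv_of_shift (by ring) h1 δ, comp_zero]

end tri

/-- integer version of the left perpendicular -/
def ZL (D : Set C) (n : ℕ) (M : C) : Prop := ∀ k : ℤ, 1 ≤ k → k ≤ n → ∀ d ∈ D, HV M d k
/-- integer version of the right perpendicular -/
def ZR (D : Set C) (n : ℕ) (M : C) : Prop := ∀ k : ℤ, 1 ≤ k → k ≤ n → ∀ d ∈ D, HV d M k

lemma zl_iff (D : Set C) (n : ℕ) (M : C) : M ∈ leftPerpInter D n ↔ ZL D n M := by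
  constructor
  · intro h k h1 h2
    lift k to ℕ using by lia
    exact h k (by lia) (by lia)
  · intro h k h1 h2
    exact h k (by lia) (by lia)

lemma zr_iff (D : Set C) (n : ℕ) (M : C) : M ∈ rightPerpInter D n ↔ ZR D n M := by
  constructor
  · intro h k h1 h2
    lift k to ℕ using by lia
    exact h k (by lia) (by lia)
  · intro h k h1 h2
    exact h k (by lia) (by lia)

lemma zl_anti {D E : Set C} (h : D ⊆ E) {n : ℕ} {M : C} (hM : ZL E n M) : ZL D n M :=
  fun k h1 h2 d hd => hM k h1 h2 d (h hd)
lemma zr_anti {D E : Set C} (h : D ⊆ E) {n : ℕ} {M : C} (hM : ZR E n M) : ZR D n M :=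
  fun k h1 h2 d hd => hM k h1 h2 d (h hd)

lemma zl_biprod {D : Set C} {n : ℕ} {M N : C} (hM : ZL D n M) (hN : ZL D n N) :
    ZL D n (M ⊞ N) := fun k h1 h2 d hd f => by
  apply biprod.hom_ext'
  · rw [hM k h1 h2 d hd (biprod.inl ≫ f), comp_zero]
  · rw [hN k h1 h2 d hd (biprod.inr ≫ f), comp_zero]

lemma zr_biprod {D : Set C} {n : ℕ} {M N : C} (hM : ZR D n M) (hN : ZR D n N) :
    ZR D n (M ⊞ N) := fun k h1 h2 d hd f => by
  have e : 𝟙 (M ⊞ N) = biprod.fst ≫ biprod.inl + biprod.snd ≫ biprod.inr := by simp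
  rw [← comp_id f, ← (shiftFunctor C k).map_id, e, Functor.map_add, Preadditive.comp_add,
    Functor.map_comp, Functor.map_comp, ← assoc, ← assoc,
    hM k h1 h2 d hd (f ≫ biprod.fst⟦k⟧'), hN k h1 h2 d hd (f ≫ biprod.snd⟦k⟧')]
  simp


section mutn
variable {D : Set C} {n : ℕ}

/-- triangle exhibiting `M` as mutation of `A` -/
structure MT (D : Set C) (n : ℕ) {A d M : C} (f : A ⟶ d) (g : d ⟶ M)
    (h : M ⟶ A⟦(1 : ℤ)⟧) : Prop where
  T : Triangle.mk f g h ∈ distTriang C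
  l : IsLeftApprox D f
  r : IsRightApprox D g
  AL : ZL D n A
  AR : ZR D n A
  ML : ZL D n M
  MR : ZR D n M

lemma mt_of_left (hn : 1 ≤ n) (hZ : ∀ M : C, ZL D n M ↔ ZR D n M) (rig : ∀ d ∈ D, ZL D n d)
    {A d M : C} {f : A ⟶ d} {g : d ⟶ M} {h : M ⟶ A⟦(1 : ℤ)⟧}
    (T : Triangle.mk f g h ∈ distTriang C) (l : IsLeftApprox D f) (hA : ZL D n A) :
    MT D n f g h := by
  have hM : ZL D n M := by
    intro k h1 h2 d' hd' φ
    obtain ⟨β, rfl⟩ := yo₃ T φ (rig d l.1 k h1 h2 d' hd' _)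
    rcases h1.eq_or_lt with rfl | h3
    · obtain ⟨β, rfl⟩ := (shiftFunctor C (1 : ℤ)).map_surjective β
      obtain ⟨u, rfl⟩ := l.2 d' hd' β
      rw [Functor.map_comp, ← assoc, tri_z₃ T, zero_comp]
    · rw [hv_of_shift₁ (k := k - 1) (by ring) (hA (k - 1) (by lia) (by lia) d' hd') β, comp_zero]
  refine ⟨T, l, ⟨l.1, fun d' hd' u => ?_⟩, hA, (hZ _).1 hA, hM, (hZ _).1 hM⟩
  obtain ⟨v, hv⟩ := co₃ T u
    ((hZ _).1 hA 1 le_rfl (by lia) d' hd' _)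
  exact ⟨v, hv.symm⟩

lemma mt_of_right (hn : 1 ≤ n) (hZ : ∀ M : C, ZL D n M ↔ ZR D n M) (rig : ∀ d ∈ D, ZL D n d)
    {A d M : C} {f : A ⟶ d} {g : d ⟶ M} {h : M ⟶ A⟦(1 : ℤ)⟧}
    (T : Triangle.mk f g h ∈ distTriang C) (r : IsRightApprox D g) (hM : ZL D n M) :
    MT D n f g h := by
  have hA : ZR D n A := by
    intro k h1 h2 d' hd'
    rcases h1.eq_or_lt with rfl | h3
    · intro β
      obtain ⟨γ, hγ⟩ := co₁ T β (rig d' hd' 1 le_rfl h2 d r.1 _)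
      obtain ⟨u, rfl⟩ := r.2 d' hd' γ
      rw [hγ]
      rw [assoc, tri_z₂ T, comp_zero]
    · refine hv_to_shift₂ (b := 1) (c := k - 1) (by ring) (fun β => ?_)
      obtain ⟨γ, rfl⟩ := sh_ex₁ T (k - 1) β
        (hv_of_shift₂ (by ring) (rig d' hd' k h1 h2 d r.1) _)
      rw [(hZ _).1 hM (k - 1) (by lia) (by lia) d' hd' γ, zero_comp]
  refine ⟨T, ⟨r.1, fun d' hd' u => ?_⟩, r, (hZ _).2 hA, hA, hM, (hZ _).1 hM⟩
  obtain ⟨v, hv⟩ := yo₁ T u (hM 1 le_rfl (by lia) d' hd' _)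
  exact ⟨v, hv.symm⟩

lemma exists_right_mt (hn : 1 ≤ n) (hZ : ∀ M : C, ZL D n M ↔ ZR D n M)
    (rig : ∀ d ∈ D, ZL D n d) (hc : ContravariantlyFinite D) (M : C) (hM : ZL D n M) :
    ∃ (A d : C) (f : A ⟶ d) (g : d ⟶ M) (h : M ⟶ A⟦(1 : ℤ)⟧), MT D n f g h := by
  obtain ⟨d, g, r⟩ := hc M
  obtain ⟨A, f, h, T⟩ := distinguished_cocone_triangle₁ g
  exact ⟨A, d, f, g, h, mt_of_right hn hZ rig T r hM⟩

lemma exists_left_mt (hn : 1 ≤ n) (hZ : ∀ M : C, ZL D n M ↔ ZR D n M)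
    (rig : ∀ d ∈ D, ZL D n d) (hc : CovariantlyFinite D) (A : C) (hA : ZL D n A) :
    ∃ (M d : C) (f : A ⟶ d) (g : d ⟶ M) (h : M ⟶ A⟦(1 : ℤ)⟧), MT D n f g h := by
  obtain ⟨d, f, l⟩ := hc A
  obtain ⟨M, g, h, T⟩ := distinguished_cocone_triangle f
  exact ⟨M, d, f, g, h, mt_of_left hn hZ rig T l hA⟩

lemma MT.hv_iff {A d M : C} {f : A ⟶ d} {g : d ⟶ M} {h : M ⟶ A⟦(1 : ℤ)⟧} (t : MT D n f g h)
    {A' d' M' : C} {f' : A' ⟶ d'} {g' : d' ⟶ M'} {h' : M' ⟶ A'⟦(1 : ℤ)⟧} (t' : MT D n f' g' h')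
    {k : ℤ} (h1 : 1 ≤ k) (h2 : k ≤ n) : HV M M' k ↔ HV A A' k :=
  ⟨fun H => hv_unmut t.T t'.T (t'.AR k h1 h2 d t.l.1) H (t.AL k h1 h2 d' t'.l.1),
   fun H => hv_mut t.T t'.T (t'.MR k h1 h2 d t.l.1) H (t.ML k h1 h2 d' t'.l.1)⟩

lemma left_approx_Z (rig : ∀ d ∈ D, ZL D n d) (hc : CovariantlyFinite D) (W : C) (m : ℕ)
    (hm : m ≤ n) : ∃ (W' : C) (p : W' ⟶ W),
      (∀ k : ℤ, n - m < k → k ≤ n → ∀ d ∈ D, HV W' d k) ∧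
      ∀ z : C, ZL D n z → ∀ u : z ⟶ W, ∃ v : z ⟶ W', v ≫ p = u := by
  induction m with
  | zero => exact ⟨W, 𝟙 W, fun k h1 h2 => by lia, fun z _ u => ⟨u, comp_id _⟩⟩
  | succ m ih =>
    obtain ⟨W₁, p, hp, hf⟩ := ih (by lia)
    obtain ⟨k, hk⟩ : ∃ k : ℤ, k = n - m := ⟨_, rfl⟩
    obtain ⟨d, q0, hd, hq0⟩ := hc (W₁⟦-k⟧)
    let q : W₁ ⟶ d⟦k⟧ := (shiftNegShift W₁ k).inv ≫ q0⟦k⟧'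
    obtain ⟨W', i, r, T⟩ := distinguished_cocone_triangle₁ q
    refine ⟨W', i ≫ p, ?_, ?_⟩
    · intro j h1 h2 d' hd' φ
      obtain ⟨ψ, rfl⟩ := yo₁ T φ
        (hv_of_shift (k := j + 1 - k) (by ring)
          (rig d hd (j + 1 - k) (by push_cast at h1; lia) (by push_cast at h1; lia) d' hd') _)
      rcases (show k = j ∨ k < j by push_cast at h1; lia) with rfl | h3
      · obtain ⟨ψ0, rfl⟩ := unshift_map k ψ
        obtain ⟨v, rfl⟩ := hq0 d' hd' ψ0
        rw [Functor.map_comp, ← assoc (shiftNegShift W₁ k).inv, ← assoc]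
        change (i ≫ q) ≫ _ = 0
        rw [tri_z₁ T, zero_comp]
      · rw [hp j (by lia) h2 d' hd' ψ, comp_zero]
    · intro z hz u
      obtain ⟨v, rfl⟩ := hf z hz u
      obtain ⟨w, hw⟩ := co₂ T v
        (hz k (by push_cast at hm; lia) (by lia) d hd _)
      exact ⟨w, by rw [hw, assoc]⟩

lemma right_approx_Z (rig : ∀ d ∈ D, ZL D n d) (hc : ContravariantlyFinite D) (W : C) (m : ℕ)
    (hm : m ≤ n) : ∃ (W' : C) (p : W ⟶ W'),
      (∀ k : ℤ, n - m < k → k ≤ n → ∀ d ∈ D, HV d W' k) ∧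
      ∀ z : C, ZR D n z → ∀ u : W ⟶ z, ∃ v : W' ⟶ z, p ≫ v = u := by
  induction m with
  | zero => exact ⟨W, 𝟙 W, fun k h1 h2 => by lia, fun z _ u => ⟨u, id_comp _⟩⟩
  | succ m ih =>
    obtain ⟨W₁, p, hp, hf⟩ := ih (by lia)
    obtain ⟨k, hk⟩ : ∃ k : ℤ, k = n - m := ⟨_, rfl⟩
    obtain ⟨d, q0, hd, hq0⟩ := hc (W₁⟦k⟧)
    obtain ⟨q, e⟩ := unshift_map k q0
    obtain ⟨W', i, r, T⟩ := distinguished_cocone_triangle q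
    refine ⟨W', p ≫ i, ?_, ?_⟩
    · intro j h1 h2 d' hd' φ
      have z : φ ≫ r⟦j⟧' = 0 := by
        let e := (shiftFunctorAdd' C (-k) 1 (1 - k) (by ring)).app d
        have z1 : φ ≫ r⟦j⟧' ≫ e.inv⟦j⟧' = 0 := hv_of_shift₂ (k := j + 1 - k) (by ring)
          (rig d' hd' (j + 1 - k) (by push_cast at h1; lia) (by push_cast at h1; lia) d hd) _
        rw [← cancel_mono (e.inv⟦j⟧'), assoc, zero_comp]
        exact z1
      obtain ⟨ψ, rfl⟩ := sh_ex₃ T j φ z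
      rcases (show k = j ∨ k < j by push_cast at h1; lia) with rfl | h3
      · obtain ⟨v, rfl⟩ := hq0 d' hd' ψ
        rw [e, assoc, assoc, ← Functor.map_comp, tri_z₁ T, Functor.map_zero, comp_zero, comp_zero]
      · rw [hp j (by lia) h2 d' hd' ψ, zero_comp]
    · intro z hz u
      obtain ⟨v, rfl⟩ := hf z hz u
      have zz : q ≫ v = 0 := by
        let e := shiftFunctorCompIsoId C k (-k) (add_neg_cancel k)
        rw [← cancel_mono (e.inv.app z)]
        rw [hv_of_shift (k := k) (by ring) (hz k (by push_cast at hm; lia) (by lia) d hd)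
          ((q ≫ v) ≫ e.inv.app z), zero_comp]
      obtain ⟨w, hw⟩ := yo₂ T v zz
      exact ⟨w, by rw [hw, assoc]⟩

end mutn

lemma ncp_iff (n : ℕ) (U V : Set C) : NCotorsionPair n U V ↔
    (∀ M, M ∈ U ↔ ZL V n M) ∧ (∀ M, M ∈ V ↔ ZR U n M) ∧
    ContravariantlyFinite U ∧ CovariantlyFinite V := by
  have a : NCotorsionPair n U V ↔ (U = leftPerpInter V n ∧ V = rightPerpInter U n ∧
    ContravariantlyFinite U ∧ CovariantlyFinite V) := Iff.rfl
  rw [a, Set.ext_iff, Set.ext_iff]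
  simp only [zl_iff, zr_iff]

/-- the forward mutation of an `n`-cotorsion pair `(X, Y)` at a
functorially finite `D ⊆ I(X) = X ∩ Y` with `⋂ₖ {}^{⊥ₖ}D = ⋂ₖ D^{⊥ₖ}` is again an
`n`-cotorsion pair, with core `I(μ⁻¹_D(X)) = μ⁻¹_D(I(X))`. -/
theorem stmt10 (n : ℕ) (hn : 1 ≤ n) (X Y D : Set C)
    (hXiso : ∀ ⦃A B : C⦄, (A ≅ B) → A ∈ X → B ∈ X)
    (hYiso : ∀ ⦃A B : C⦄, (A ≅ B) → A ∈ Y → B ∈ Y)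
    (hXsum : ∀ A B : C, B ∈ X → ∀ (i : A ⟶ B) (r : B ⟶ A), i ≫ r = 𝟙 A → A ∈ X)
    (hYsum : ∀ A B : C, B ∈ Y → ∀ (i : A ⟶ B) (r : B ⟶ A), i ≫ r = 𝟙 A → A ∈ Y)
    (hpair : NCotorsionPair n X Y)
    (hD : D ⊆ X ∩ Y)
    (hcontra : ContravariantlyFinite D) (hcov : CovariantlyFinite D)
    (hZ : leftPerpInter D n = rightPerpInter D n) :
    NCotorsionPair n (forwardMut D X) (forwardMut D Y) ∧
      forwardMut D X ∩ forwardMut D Y = forwardMut D (X ∩ Y) := by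
  have hZ' : ∀ M : C, ZL D n M ↔ ZR D n M := fun M => by rw [← zl_iff, ← zr_iff, hZ]
  rw [ncp_iff] at hpair
  obtain ⟨hX, hY, cX, cY⟩ := hpair
  have DX : D ⊆ X := fun d hd => (hD hd).1
  have DY : D ⊆ Y := fun d hd => (hD hd).2
  have XZ : ∀ A ∈ X, ZL D n A := fun A hA => zl_anti DY ((hX A).1 hA)
  have YZ : ∀ A ∈ Y, ZL D n A := fun A hA => (hZ' A).2 (zr_anti DX ((hY A).1 hA))
  have rig : ∀ d ∈ D, ZL D n d := fun d hd => XZ d (DX hd)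
  have mk : ∀ {S : Set C} (_ : ∀ A ∈ S, ZL D n A) {M : C}, M ∈ forwardMut D S →
      ∃ (A d : C) (f : A ⟶ d) (g : d ⟶ M) (h : M ⟶ A⟦(1 : ℤ)⟧), A ∈ S ∧ MT D n f g h := by
    rintro S hS M ⟨A, d, hA, hd, f, g, h, T, l⟩
    exact ⟨A, d, f, g, h, hA, mt_of_left hn hZ' rig T l (hS A hA)⟩
  have mem : ∀ {S : Set C} {A d M : C} {f : A ⟶ d} {g : d ⟶ M} {h : M ⟶ A⟦(1 : ℤ)⟧},
      MT D n f g h → A ∈ S → M ∈ forwardMut D S := fun t hA =>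
    ⟨_, _, hA, t.l.1, _, _, _, t.T, t.l⟩
  have Dmut : ∀ {S : Set C}, (0 : C) ∈ S → D ⊆ forwardMut D S := by
    intro S h0 d hd
    exact ⟨0, d, h0, hd, 0, 𝟙 d, 0, contractible_distinguished₁ d, hd,
      fun d' _ u => ⟨0, by simp [eq_iff_true_of_subsingleton]⟩⟩
  have X0 : (0 : C) ∈ X := (hX 0).2 (fun k _ _ d _ f => (isZero_zero C).eq_of_src _ _)
  have Y0 : (0 : C) ∈ Y := (hY 0).2 (fun k _ _ d _ f =>
    ((shiftFunctor C k).map_isZero (isZero_zero C)).eq_of_tgt _ _)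
  have keyX : ∀ {A d M : C} {f : A ⟶ d} {g : d ⟶ M} {h : M ⟶ A⟦(1 : ℤ)⟧}, MT D n f g h →
      ZL (forwardMut D Y) n M → A ∈ X := by
    intro A d M f g h t hM
    rw [hX]
    intro k h1 h2 B hB
    obtain ⟨N, d', f', g', h', t'⟩ := exists_left_mt hn hZ' rig hcov B (YZ B hB)
    exact (t.hv_iff t' h1 h2).1 (hM k h1 h2 N (mem t' hB))
  have keyY : ∀ {A d M : C} {f : A ⟶ d} {g : d ⟶ M} {h : M ⟶ A⟦(1 : ℤ)⟧}, MT D n f g h →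
      ZR (forwardMut D X) n M → A ∈ Y := by
    intro A d M f g h t hM
    rw [hY]
    intro k h1 h2 B hB
    obtain ⟨N, d', f', g', h', t'⟩ := exists_left_mt hn hZ' rig hcov B (XZ B hB)
    exact (t'.hv_iff t h1 h2).1 (hM k h1 h2 N (mem t' hB))
  have orth : ∀ M ∈ forwardMut D X, ∀ N ∈ forwardMut D Y, ∀ k : ℤ, 1 ≤ k → k ≤ n → HV M N k := by
    intro M hM N hN k h1 h2
    obtain ⟨A, d, f, g, h, hA, t⟩ := mk XZ hM
    obtain ⟨B, d', f', g', h', hB, t'⟩ := mk YZ hN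
    exact (t.hv_iff t' h1 h2).2 ((hX A).1 hA k h1 h2 B hB)
  have hX' : ∀ M, M ∈ forwardMut D X ↔ ZL (forwardMut D Y) n M := by
    intro M
    refine ⟨fun hM k h1 h2 N hN => orth M hM N hN k h1 h2, fun hM => ?_⟩
    obtain ⟨A, d, f, g, h, t⟩ := exists_right_mt hn hZ' rig hcontra M (zl_anti (Dmut Y0) hM)
    exact mem t (keyX t hM)
  have hY' : ∀ M, M ∈ forwardMut D Y ↔ ZR (forwardMut D X) n M := by
    intro N
    refine ⟨fun hN k h1 h2 M hM => orth M hM N hN k h1 h2, fun hM => ?_⟩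
    obtain ⟨A, d, f, g, h, t⟩ := exists_right_mt hn hZ' rig hcontra N
      ((hZ' N).2 (zr_anti (Dmut X0) hM))
    exact mem t (keyY t hM)
  refine ⟨(ncp_iff _ _ _).2 ⟨hX', hY', ?_, ?_⟩, ?_⟩
  · intro W₀
    obtain ⟨W, p, hW, hp⟩ := left_approx_Z rig hcov W₀ n le_rfl
    replace hW : ZL D n W := fun k h1 h2 => hW k (by lia) h2
    obtain ⟨B, d, f, g, h, t⟩ := exists_right_mt hn hZ' rig hcontra W hW
    obtain ⟨A, a, hA, ha⟩ := cX B
    obtain ⟨M, dA, fA, gA, hA', tA⟩ := exists_left_mt hn hZ' rig hcov A (XZ A hA)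
    obtain ⟨b, hb⟩ := tA.l.2 d t.l.1 (a ≫ f)
    obtain ⟨c, hc1, hc2⟩ := tr3 tA.T t.T a b hb
    refine ⟨M ⊞ d, biprod.desc c g ≫ p, ?_, ?_⟩
    · rw [hX']
      exact zl_biprod ((hX' M).1 (mem tA hA)) ((hX' d).1 (Dmut X0 t.l.1))
    · intro M' hM' u
      obtain ⟨A', d', f', g', h', hA1, t'⟩ := mk XZ hM'
      obtain ⟨u, rfl⟩ := hp M' t'.ML u
      obtain ⟨v, hv⟩ := t.r.2 d' t'.l.1 (g' ≫ u)
      obtain ⟨w, hw1, hw2⟩ := tr3₁ t'.T t.T v u hv.symm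
      obtain ⟨x, rfl⟩ := ha A' hA1 w
      obtain ⟨y, hy⟩ := t'.l.2 dA tA.l.1 (x ≫ fA)
      obtain ⟨s, hs1, hs2⟩ := tr3 t'.T tA.T x y hy
      obtain ⟨r, hr⟩ := co₃ t.T (u - s ≫ c) (by
        rw [Preadditive.sub_comp, assoc, ← hc2, ← assoc, ← hs2, ← hw2, assoc, Functor.map_comp,
          sub_self])
      refine ⟨biprod.lift s r, ?_⟩
      rw [← assoc, biprod.lift_desc, ← hr]
      simp
  · intro W₀
    obtain ⟨W, p, hW, hp⟩ := right_approx_Z rig hcontra W₀ n le_rfl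
    replace hW : ZR D n W := fun k h1 h2 => hW k (by lia) h2
    obtain ⟨B, d, f, g, h, t⟩ := exists_right_mt hn hZ' rig hcontra W ((hZ' W).2 hW)
    obtain ⟨A, a, hA, ha⟩ := cY B
    obtain ⟨N, dA, fA, gA, hA', tA⟩ := exists_left_mt hn hZ' rig hcov A (YZ A hA)
    obtain ⟨b, hb⟩ := t.l.2 dA tA.l.1 (a ≫ fA)
    obtain ⟨c, hc1, hc2⟩ := tr3 t.T tA.T a b hb
    obtain ⟨dW, q, hq, hq'⟩ := hcov W
    refine ⟨N ⊞ dW, p ≫ biprod.lift c q, ?_, ?_⟩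
    · rw [hY']
      exact zr_biprod ((hY' N).1 (mem tA hA)) ((hY' dW).1 (Dmut Y0 hq))
    · intro N' hN' u
      obtain ⟨A', d', f', g', h', hA1, t'⟩ := mk YZ hN'
      obtain ⟨u, rfl⟩ := hp N' t'.MR u
      obtain ⟨v, hv⟩ := t'.r.2 d t.l.1 (g ≫ u)
      obtain ⟨w, hw1, hw2⟩ := tr3₁ t.T t'.T v u hv.symm
      obtain ⟨x, rfl⟩ := ha A' hA1 w
      obtain ⟨y, hy⟩ := tA.l.2 d' t'.l.1 (x ≫ f')
      obtain ⟨s, hs1, hs2⟩ := tr3 tA.T t'.T x y hy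
      obtain ⟨r, hr⟩ := co₃ t'.T (u - c ≫ s) (by
        rw [Preadditive.sub_comp, assoc, ← hs2, ← assoc, ← hc2, ← hw2, assoc, Functor.map_comp,
          sub_self])
      obtain ⟨r', rfl⟩ := hq' d' t'.l.1 r
      refine ⟨biprod.desc s (r' ≫ g'), ?_⟩
      rw [assoc, biprod.lift_desc, ← assoc q, ← hr]
      simp
  · ext M
    constructor
    · rintro ⟨h1, h2⟩
      obtain ⟨A, d, f, g, h, hA, t⟩ := mk XZ h1
      exact mem t ⟨hA, keyY t ((hY' M).1 h2)⟩
    · rintro ⟨A, d, hA, hd, r⟩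
      exact ⟨⟨A, d, hA.1, hd, r⟩, ⟨A, d, hA.2, hd, r⟩⟩
end

section
/- Let C be a triangulated category, n ≥ 1, let (𝒳, 𝒴) be an n-cotorsion pair in C, and let 𝒟 ⊆ I(𝒳) be a functorially finite subcategory satisfying ⋂_{k=1}^{n} {}^{⊥_k}𝒟 = ⋂_{k=1}^{n} 𝒟^{⊥_k}. Then (μ_𝒟(𝒳), μ_𝒟(𝒴)) is an n-cotorsion pair in C, and its core satisfies I(μ_𝒟(𝒳)) = μ_𝒟(I(𝒳)). -/
open CategoryTheory Category Limits Pretriangulated ZeroObject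

variable {C : Type*} [Category C] [Preadditive C] [HasZeroObject C]
  [HasShift C ℤ] [∀ n : ℤ, (shiftFunctor C n).Additive] [Pretriangulated C]
  [IsTriangulated C]

set_option linter.unusedSectionVars false

lemma exists_unshift (A : C) (k : ℤ) : ∃ P : C, Nonempty (P⟦k⟧ ≅ A) :=
  ⟨A⟦-k⟧, ⟨(shiftFunctorCompIsoId C (-k) k (by simp)).app A⟩⟩

/-- exactness at the second shifted spot -/
lemma cy2 {X1 X2 X3 : C} {f : X1 ⟶ X2} {g : X2 ⟶ X3} {h : X3 ⟶ X1⟦(1 : ℤ)⟧}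
    (hT : Triangle.mk f g h ∈ distTriang C) (k : ℤ) {A : C} (u : A ⟶ X2⟦k⟧)
    (hu : u ≫ g⟦k⟧' = 0) : ∃ v : A ⟶ X1⟦k⟧, u = v ≫ f⟦k⟧' := by
  obtain ⟨P, ⟨e⟩⟩ := exists_unshift A k
  obtain ⟨u0, hu0⟩ := (shiftFunctor C k).map_surjective (e.hom ≫ u)
  have h0 : u0 ≫ g = 0 := by
    apply (shiftFunctor C k).map_injective
    rw [Functor.map_comp, hu0, assoc, hu, comp_zero, Functor.map_zero]
  obtain ⟨v0, hv1⟩ : ∃ v0 : P ⟶ X1, u0 = v0 ≫ f := Triangle.coyoneda_exact₂ _ hT (X := P) u0 h0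
  refine ⟨e.inv ≫ v0⟦k⟧', ?_⟩
  rw [assoc, ← Functor.map_comp, ← hv1, hu0]; simp

lemma cy3 {X1 X2 X3 : C} {f : X1 ⟶ X2} {g : X2 ⟶ X3} {h : X3 ⟶ X1⟦(1 : ℤ)⟧}
    (hT : Triangle.mk f g h ∈ distTriang C) (k : ℤ) {A : C} (u : A ⟶ X3⟦k⟧)
    (hu : u ≫ h⟦k⟧' = 0) : ∃ v : A ⟶ X2⟦k⟧, u = v ≫ g⟦k⟧' :=
  cy2 (rot_of_distTriang _ hT) k u hu

lemma cy1 {X1 X2 X3 : C} {f : X1 ⟶ X2} {g : X2 ⟶ X3} {h : X3 ⟶ X1⟦(1 : ℤ)⟧}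
    (hT : Triangle.mk f g h ∈ distTriang C) (j k : ℤ) (hk : 1 + j = k)
    {A : C} (u : A ⟶ X1⟦k⟧) (hu : u ≫ f⟦k⟧' = 0) :
    ∃ v : A ⟶ X3⟦j⟧, u = v ≫ h⟦j⟧' ≫ (shiftFunctorAdd' C 1 j k hk).inv.app X1 := by
  have hu' : (u ≫ (shiftFunctorAdd' C 1 j k hk).hom.app X1) ≫ (f⟦(1 : ℤ)⟧')⟦j⟧' = 0 := by
    have := (shiftFunctorAdd' C 1 j k hk).hom.naturality f
    dsimp at this
    rw [assoc, ← this, reassoc_of% hu, zero_comp]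
  have hneg : (u ≫ (shiftFunctorAdd' C 1 j k hk).hom.app X1) ≫ (-f⟦(1 : ℤ)⟧')⟦j⟧' = 0 := by
    rw [Functor.map_neg, Preadditive.comp_neg, hu', neg_zero]
  obtain ⟨v, hv'⟩ : ∃ v : A ⟶ X3⟦j⟧,
      u ≫ (shiftFunctorAdd' C 1 j k hk).hom.app X1 = v ≫ h⟦j⟧' :=
    cy3 (rot_of_distTriang _ hT) j _ hneg
  refine ⟨v, ?_⟩
  rw [← assoc, ← hv']; simp

lemma yo1 {X1 X2 X3 : C} {f : X1 ⟶ X2} {g : X2 ⟶ X3} {h : X3 ⟶ X1⟦(1 : ℤ)⟧}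
    (hT : Triangle.mk f g h ∈ distTriang C) {W : C} (u : X1 ⟶ W)
    (hu : h ≫ u⟦(1 : ℤ)⟧' = 0) : ∃ v : X2 ⟶ W, u = f ≫ v := by
  obtain ⟨v, hv'⟩ : ∃ v : X2⟦(1 : ℤ)⟧ ⟶ W⟦(1 : ℤ)⟧, u⟦(1 : ℤ)⟧' = (-f⟦(1 : ℤ)⟧') ≫ v :=
    Triangle.yoneda_exact₃ _ (rot_of_distTriang _ hT) (u⟦(1 : ℤ)⟧') hu
  obtain ⟨v0, hv0⟩ := (shiftFunctor C (1 : ℤ)).map_surjective v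
  refine ⟨-v0, (shiftFunctor C (1 : ℤ)).map_injective ?_⟩
  rw [hv', ← hv0]; simp

lemma yo2 {X1 X2 X3 : C} {f : X1 ⟶ X2} {g : X2 ⟶ X3} {h : X3 ⟶ X1⟦(1 : ℤ)⟧}
    (hT : Triangle.mk f g h ∈ distTriang C) {W : C} (u : X2 ⟶ W)
    (hu : f ≫ u = 0) : ∃ v : X3 ⟶ W, u = g ≫ v :=
  Triangle.yoneda_exact₂ _ hT u hu

/-- a map from the third object killed by `g`, in a shifted form -/
lemma yo3 {X1 X2 X3 : C} {f : X1 ⟶ X2} {g : X2 ⟶ X3} {h : X3 ⟶ X1⟦(1 : ℤ)⟧}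
    (hT : Triangle.mk f g h ∈ distTriang C) (j k : ℤ) (hk : j + 1 = k) {W : C}
    (u : X3 ⟶ W⟦k⟧) (hu : g ≫ u = 0) :
    ∃ v : X1 ⟶ W⟦j⟧, u = h ≫ v⟦(1 : ℤ)⟧' ≫ (shiftFunctorAdd' C j 1 k hk).inv.app W := by
  obtain ⟨v, hv'⟩ : ∃ v : X1⟦(1 : ℤ)⟧ ⟶ W⟦k⟧, u = h ≫ v := Triangle.yoneda_exact₃ _ hT u hu
  obtain ⟨v0, hv0⟩ := (shiftFunctor C (1 : ℤ)).map_surjective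
    (v ≫ (shiftFunctorAdd' C j 1 k hk).hom.app W)
  refine ⟨v0, ?_⟩
  rw [hv0, hv']; simp

lemma z12 {X1 X2 X3 : C} {f : X1 ⟶ X2} {g : X2 ⟶ X3} {h : X3 ⟶ X1⟦(1 : ℤ)⟧}
    (hT : Triangle.mk f g h ∈ distTriang C) : f ≫ g = 0 := comp_distTriang_mor_zero₁₂ _ hT
lemma z23 {X1 X2 X3 : C} {f : X1 ⟶ X2} {g : X2 ⟶ X3} {h : X3 ⟶ X1⟦(1 : ℤ)⟧}
    (hT : Triangle.mk f g h ∈ distTriang C) : g ≫ h = 0 := comp_distTriang_mor_zero₂₃ _ hT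
lemma z31 {X1 X2 X3 : C} {f : X1 ⟶ X2} {g : X2 ⟶ X3} {h : X3 ⟶ X1⟦(1 : ℤ)⟧}
    (hT : Triangle.mk f g h ∈ distTriang C) : h ≫ f⟦(1 : ℤ)⟧' = 0 :=
  comp_distTriang_mor_zero₃₁ _ hT

/-- vanishing of `Ext^k` for `1 ≤ k ≤ n` -/
def EV (n : ℕ) (A B : C) : Prop :=
  ∀ k : ℕ, 1 ≤ k → k ≤ n → ∀ f : A ⟶ B⟦(k : ℤ)⟧, f = 0

/-- the data of a mutation triangle; all objects in `Z` -/
structure MT_s11 (n : ℕ) (D : Set C) {M d B : C} (f : M ⟶ d) (g : d ⟶ B)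
    (h : B ⟶ M⟦(1 : ℤ)⟧) : Prop where
  hT : Triangle.mk f g h ∈ distTriang C
  hd : d ∈ D
  ra : ∀ d' ∈ D, ∀ u : d' ⟶ B, ∃ v : d' ⟶ d, v ≫ g = u
  la : ∀ d' ∈ D, ∀ u : M ⟶ d', ∃ v : d ⟶ d', f ≫ v = u
  Ml : ∀ d' ∈ D, EV n M d'
  Mr : ∀ d' ∈ D, EV n d' M
  Bl : ∀ d' ∈ D, EV n B d'
  Br : ∀ d' ∈ D, EV n d' B

section
variable {n : ℕ} {D : Set C}

lemma mem_l {M : C} : M ∈ leftPerpInter D n ↔ ∀ d ∈ D, EV n M d :=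
  ⟨fun h d hd k h1 h2 => h k h1 h2 d hd, fun h k h1 h2 d hd => h d hd k h1 h2⟩
lemma mem_r {M : C} : M ∈ rightPerpInter D n ↔ ∀ d ∈ D, EV n d M :=
  ⟨fun h d hd k h1 h2 => h k h1 h2 d hd, fun h k h1 h2 d hd => h d hd k h1 h2⟩

lemma iff_lr (hZ : leftPerpInter D n = rightPerpInter D n) (M : C) :
    (∀ d ∈ D, EV n M d) ↔ (∀ d ∈ D, EV n d M) := by
  rw [← mem_l, ← mem_r, hZ]

lemma MT_s11.of_right (hn : 1 ≤ n) (hZ : leftPerpInter D n = rightPerpInter D n)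
    (hR : ∀ d ∈ D, ∀ d' ∈ D, EV n d d')
    {M d B : C} {f : M ⟶ d} {g : d ⟶ B} {h : B ⟶ M⟦(1 : ℤ)⟧}
    (hT : Triangle.mk f g h ∈ distTriang C) (hd : d ∈ D)
    (ra : ∀ d' ∈ D, ∀ u : d' ⟶ B, ∃ v : d' ⟶ d, v ≫ g = u)
    (Bl : ∀ d' ∈ D, EV n B d') : MT_s11 n D f g h := by
  have Br := (iff_lr hZ B).1 Bl
  have Mr : ∀ d' ∈ D, EV n d' M := by
    intro d' hd' k h1 h2 u
    obtain ⟨j, rfl⟩ : ∃ j, k = 1 + j := ⟨k - 1, by omega⟩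
    obtain ⟨v, rfl⟩ := cy1 hT (j : ℤ) ((1 + j : ℕ) : ℤ) (by push_cast; rfl) u
      (hR _ hd' _ hd _ h1 h2 _)
    rcases Nat.eq_zero_or_pos j with rfl | hj
    · obtain ⟨w, hw⟩ := ra d' hd' (v ≫ (shiftFunctorZero C ℤ).hom.app B)
      have hv : v ≫ h⟦((0 : ℕ) : ℤ)⟧' = 0 := by
        have nat := (shiftFunctorZero C ℤ).hom.naturality h
        dsimp at nat
        have : (v ≫ h⟦(0 : ℤ)⟧') ≫ (shiftFunctorZero C ℤ).hom.app _ = 0 := by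
          rw [assoc, nat, ← assoc]
          erw [← hw]
          rw [assoc, z23 hT, comp_zero]
        exact (cancel_mono _).1 (this.trans zero_comp.symm)
      rw [← assoc, hv, zero_comp]
    · rw [Br d' hd' j hj (by omega) v, zero_comp]
  refine ⟨hT, hd, ra, ?_, (iff_lr hZ M).2 Mr, Mr, Bl, Br⟩
  intro d' hd' u
  obtain ⟨v, hv⟩ := yo1 hT u (Bl d' hd' 1 le_rfl hn _)
  exact ⟨v, hv.symm⟩

lemma MT_s11.of_left (hn : 1 ≤ n) (hZ : leftPerpInter D n = rightPerpInter D n)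
    (hR : ∀ d ∈ D, ∀ d' ∈ D, EV n d d')
    {M d B : C} {f : M ⟶ d} {g : d ⟶ B} {h : B ⟶ M⟦(1 : ℤ)⟧}
    (hT : Triangle.mk f g h ∈ distTriang C) (hd : d ∈ D)
    (la : ∀ d' ∈ D, ∀ u : M ⟶ d', ∃ v : d ⟶ d', f ≫ v = u)
    (Ml : ∀ d' ∈ D, EV n M d') : MT_s11 n D f g h := by
  have Mr := (iff_lr hZ M).1 Ml
  have Bl : ∀ d' ∈ D, EV n B d' := by
    intro d' hd' k h1 h2 u
    obtain ⟨j, rfl⟩ : ∃ j, k = j + 1 := ⟨k - 1, by omega⟩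
    obtain ⟨v, rfl⟩ := yo3 hT (j : ℤ) ((j + 1 : ℕ) : ℤ) (by push_cast; rfl) u
      (hR _ hd _ hd' _ h1 h2 _)
    rcases Nat.eq_zero_or_pos j with rfl | hj
    · obtain ⟨w, hw⟩ := la d' hd' (v ≫ (shiftFunctorZero C ℤ).hom.app d')
      have hv : v = f ≫ w ≫ (shiftFunctorZero C ℤ).inv.app d' := by
        rw [← assoc, hw, assoc]
        erw [Iso.hom_inv_id_app]
        exact (comp_id _).symm
      rw [hv, Functor.map_comp, assoc, ← assoc h, z31 hT, zero_comp]
    · rw [Ml d' hd' j hj (by omega) v]; simp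
  refine ⟨hT, hd, ?_, la, Ml, Mr, Bl, (iff_lr hZ B).1 Bl⟩
  intro d' hd' u
  obtain ⟨v, hv⟩ : ∃ v : d' ⟶ d, u = v ≫ g := Triangle.coyoneda_exact₃ _ hT u (Mr d' hd' 1 le_rfl hn _)
  exact ⟨v, hv.symm⟩

lemma MT_s11.fwd {M d B M' d' B' : C} {f : M ⟶ d} {g : d ⟶ B} {h : B ⟶ M⟦(1 : ℤ)⟧}
    {f' : M' ⟶ d'} {g' : d' ⟶ B'} {h' : B' ⟶ M'⟦(1 : ℤ)⟧}
    (t : MT_s11 n D f g h) (t' : MT_s11 n D f' g' h') (hB : EV n B B') : EV n M M' := by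
  intro k h1 h2 u
  obtain ⟨j, rfl⟩ : ∃ j, k = 1 + j := ⟨k - 1, by omega⟩
  obtain ⟨v, rfl⟩ := cy1 t'.hT (j : ℤ) ((1 + j : ℕ) : ℤ) (by push_cast; rfl) u
      (t.Ml _ t'.hd _ h1 h2 _)
  obtain ⟨e, rfl⟩ := yo1 t.hT v (by
    have := hB (1 + j) h1 h2 (h ≫ v⟦(1 : ℤ)⟧' ≫
      (shiftFunctorAdd' C (j : ℤ) 1 ((1 + j : ℕ) : ℤ) (by push_cast; ring)).inv.app B')
    rw [← assoc] at this
    exact (cancel_mono _).1 (this.trans zero_comp.symm))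
  rw [assoc, t'.Mr _ t.hd _ h1 h2 (e ≫ _), comp_zero]

lemma MT_s11.bwd {M d B M' d' B' : C} {f : M ⟶ d} {g : d ⟶ B} {h : B ⟶ M⟦(1 : ℤ)⟧}
    {f' : M' ⟶ d'} {g' : d' ⟶ B'} {h' : B' ⟶ M'⟦(1 : ℤ)⟧}
    (t : MT_s11 n D f g h) (t' : MT_s11 n D f' g' h') (hM : EV n M M') : EV n B B' := by
  intro k h1 h2 u
  obtain ⟨j, rfl⟩ : ∃ j, k = j + 1 := ⟨k - 1, by omega⟩
  obtain ⟨v, rfl⟩ := yo3 t.hT (j : ℤ) ((j + 1 : ℕ) : ℤ) (by push_cast; rfl) u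
      (t'.Br _ t.hd _ h1 h2 _)
  obtain ⟨e, rfl⟩ := cy3 t'.hT j v (by
    have := hM (j + 1) h1 h2 (v ≫ h'⟦(j : ℤ)⟧' ≫
      (shiftFunctorAdd' C 1 (j : ℤ) ((j + 1 : ℕ) : ℤ) (by push_cast; ring)).inv.app M')
    rw [← assoc] at this
    exact (cancel_mono _).1 (this.trans zero_comp.symm))
  have nat := (shiftFunctorAdd' C (j : ℤ) 1 ((j + 1 : ℕ) : ℤ) (by push_cast; rfl)).inv.naturality g'
  dsimp only [Functor.comp_map, Functor.comp_obj] at nat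
  have h0 := t.Bl _ t'.hd _ h1 h2 (h ≫ e⟦(1 : ℤ)⟧' ≫
    (shiftFunctorAdd' C (j : ℤ) 1 ((j + 1 : ℕ) : ℤ) (by push_cast; rfl)).inv.app d')
  rw [Functor.map_comp, assoc]
  erw [nat]
  rw [← assoc (e⟦(1 : ℤ)⟧'), ← assoc h, h0, zero_comp]

end

lemma van1 {A B : C} (m k j : ℤ) (hm : m + k = j + 1)
    (hv : ∀ f : A ⟶ B⟦m⟧, f = 0) (f : A⟦k⟧ ⟶ B⟦j⟧⟦(1 : ℤ)⟧) : f = 0 := by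
  obtain ⟨f0, hf0⟩ := (shiftFunctor C k).map_surjective
    (f ≫ (shiftFunctorAdd' C j 1 (j + 1) rfl).inv.app B ≫
      (shiftFunctorAdd' C m k (j + 1) hm).hom.app B)
  rw [hv f0, Functor.map_zero] at hf0
  exact (cancel_mono _).1 (hf0.symm.trans zero_comp.symm)

lemma van2 {A B P : C} (m k j : ℤ) (hm : m + k = j + 1) (e : P⟦k⟧ ≅ B)
    (hv : ∀ f : A ⟶ B⟦m⟧, f = 0) (f : A ⟶ P⟦(1 : ℤ)⟧⟦j⟧) : f = 0 := by
  have := hv (f ≫ (shiftFunctorAdd' C 1 j (j + 1) (add_comm _ _)).inv.app P ≫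
      (shiftFunctorAdd' C k m (j + 1) (by rw [← hm, add_comm])).hom.app P ≫ e.hom⟦m⟧')
  exact (cancel_mono _).1 (this.trans zero_comp.symm)

lemma contraZ {n : ℕ} {D : Set C} (hR : ∀ d ∈ D, ∀ d' ∈ D, EV n d d')
    (hcov : CovariantlyFinite D) (T : C) :
    ∃ (W : C) (p : W ⟶ T), (∀ d ∈ D, EV n W d) ∧
      ∀ Z0 : C, (∀ d ∈ D, EV n Z0 d) → ∀ u : Z0 ⟶ T, ∃ v : Z0 ⟶ W, v ≫ p = u := by
  have key : ∀ i : ℕ, i ≤ n → ∃ (W : C) (p : W ⟶ T),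
      (∀ d ∈ D, ∀ k : ℕ, n < k + i → k ≤ n → ∀ f : W ⟶ d⟦(k : ℤ)⟧, f = 0) ∧
      ∀ Z0 : C, (∀ d ∈ D, EV n Z0 d) → ∀ u : Z0 ⟶ T, ∃ v : Z0 ⟶ W, v ≫ p = u := by
    intro i
    induction i with
    | zero => exact fun _ => ⟨T, 𝟙 T, fun d hd k h1 h2 => by omega, fun Z0 _ u => ⟨u, comp_id u⟩⟩
    | succ i ih =>
      intro hi
      obtain ⟨W, p, hW, hp⟩ := ih (by omega)
      obtain ⟨k, hk⟩ : ∃ k, k + i = n := ⟨n - i, by omega⟩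
      obtain ⟨P, ⟨e⟩⟩ := exists_unshift W (k : ℤ)
      obtain ⟨d, a, hd, ha⟩ := hcov P
      obtain ⟨W', q, h, hT⟩ := distinguished_cocone_triangle₁ (e.inv ≫ a⟦(k : ℤ)⟧')
      refine ⟨W', q ≫ p, ?_, ?_⟩
      · intro d0 hd0 j h1 h2 u
        obtain ⟨m, hm⟩ : ∃ m, m + k = j + 1 := ⟨j + 1 - k, by omega⟩
        obtain ⟨v, rfl⟩ := yo1 hT u (van1 (m : ℤ) k j (by exact_mod_cast hm)
            (hR d hd d0 hd0 m (by omega) (by omega)) _)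
        rcases Nat.lt_or_ge k j with hj | hj
        · rw [hW d0 hd0 j (by omega) h2 v, comp_zero]
        · obtain rfl : j = k := by omega
          obtain ⟨v0, hv0⟩ := (shiftFunctor C (j : ℤ)).map_surjective (e.hom ≫ v)
          obtain ⟨w, hw⟩ := ha d0 hd0 v0
          have hv : v = (e.inv ≫ a⟦(j : ℤ)⟧') ≫ w⟦(j : ℤ)⟧' := by
            rw [assoc, ← Functor.map_comp, hw, hv0, Iso.inv_hom_id_assoc]
          rw [hv, ← assoc, z12 hT, zero_comp]
      · intro Z0 hZ0 u
        obtain ⟨v, rfl⟩ := hp Z0 hZ0 u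
        obtain ⟨w, rfl⟩ : ∃ w : Z0 ⟶ W', v = w ≫ q :=
          Triangle.coyoneda_exact₂ _ hT v (hZ0 d hd k (by omega) (by omega) _)
        exact ⟨w, (assoc _ _ _).symm⟩
  obtain ⟨W, p, hW, hp⟩ := key n le_rfl
  exact ⟨W, p, fun d hd k h1 h2 => hW d hd k (by omega) h2, hp⟩

lemma covZ {n : ℕ} {D : Set C} (hR : ∀ d ∈ D, ∀ d' ∈ D, EV n d d')
    (hcontra : ContravariantlyFinite D) (T : C) :
    ∃ (W : C) (p : T ⟶ W), (∀ d ∈ D, EV n d W) ∧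
      ∀ Z0 : C, (∀ d ∈ D, EV n d Z0) → ∀ u : T ⟶ Z0, ∃ v : W ⟶ Z0, p ≫ v = u := by
  have key : ∀ i : ℕ, i ≤ n → ∃ (W : C) (p : T ⟶ W),
      (∀ d ∈ D, ∀ k : ℕ, n < k + i → k ≤ n → ∀ f : d ⟶ W⟦(k : ℤ)⟧, f = 0) ∧
      ∀ Z0 : C, (∀ d ∈ D, EV n d Z0) → ∀ u : T ⟶ Z0, ∃ v : W ⟶ Z0, p ≫ v = u := by
    intro i
    induction i with
    | zero => exact fun _ => ⟨T, 𝟙 T, fun d hd k h1 h2 => by omega, fun Z0 _ u => ⟨u, id_comp u⟩⟩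
    | succ i ih =>
      intro hi
      obtain ⟨W, p, hW, hp⟩ := ih (by omega)
      obtain ⟨k, hk⟩ : ∃ k, k + i = n := ⟨n - i, by omega⟩
      obtain ⟨d, a, hd, ha⟩ := hcontra (W⟦(k : ℤ)⟧)
      obtain ⟨P, ⟨e⟩⟩ := exists_unshift d (k : ℤ)
      obtain ⟨b, hb⟩ := (shiftFunctor C (k : ℤ)).map_surjective (e.hom ≫ a)
      obtain ⟨W', q, h, hT⟩ := distinguished_cocone_triangle b
      refine ⟨W', p ≫ q, ?_, ?_⟩
      · intro d0 hd0 j h1 h2 u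
        obtain ⟨m, hm⟩ : ∃ m, m + k = j + 1 := ⟨j + 1 - k, by omega⟩
        obtain ⟨v, rfl⟩ := cy3 hT j u (van2 (m : ℤ) k j (by exact_mod_cast hm) e
            (hR d0 hd0 d hd m (by omega) (by omega)) _)
        rcases Nat.lt_or_ge k j with hj | hj
        · rw [hW d0 hd0 j (by omega) h2 v, zero_comp]
        · obtain rfl : j = k := by omega
          obtain ⟨w, rfl⟩ := ha d0 hd0 v
          have hv : a = e.inv ≫ b⟦(j : ℤ)⟧' := by rw [hb, Iso.inv_hom_id_assoc]
          rw [hv, assoc, assoc, ← Functor.map_comp, z12 hT, Functor.map_zero, comp_zero, comp_zero]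
      · intro Z0 hZ0 u
        obtain ⟨v, rfl⟩ := hp Z0 hZ0 u
        have h0 : b ≫ v = 0 := by
          apply (shiftFunctor C (k : ℤ)).map_injective
          have := hZ0 d hd k (by omega) (by omega) (e.inv ≫ (b ≫ v)⟦(k : ℤ)⟧')
          rw [Functor.map_zero]
          exact (cancel_epi _).1 (this.trans comp_zero.symm)
        obtain ⟨w, rfl⟩ := yo2 hT v h0
        exact ⟨w, assoc _ _ _⟩
  obtain ⟨W, p, hW, hp⟩ := key n le_rfl
  exact ⟨W, p, fun d hd k h1 h2 => hW d hd k (by omega) h2, hp⟩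

/-- maps of triangles, explicit form -/
lemma cm1 {X1 X2 X3 Y1 Y2 Y3 : C} {f : X1 ⟶ X2} {g : X2 ⟶ X3} {h : X3 ⟶ X1⟦(1 : ℤ)⟧}
    {f' : Y1 ⟶ Y2} {g' : Y2 ⟶ Y3} {h' : Y3 ⟶ Y1⟦(1 : ℤ)⟧}
    (hT : Triangle.mk f g h ∈ distTriang C) (hT' : Triangle.mk f' g' h' ∈ distTriang C)
    (b : X2 ⟶ Y2) (c : X3 ⟶ Y3) (w : g ≫ c = b ≫ g') :
    ∃ a : X1 ⟶ Y1, f ≫ b = a ≫ f' ∧ h ≫ a⟦(1 : ℤ)⟧' = c ≫ h' :=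
  complete_distinguished_triangle_morphism₁ _ _ hT hT' b c w

lemma cm3 {X1 X2 X3 Y1 Y2 Y3 : C} {f : X1 ⟶ X2} {g : X2 ⟶ X3} {h : X3 ⟶ X1⟦(1 : ℤ)⟧}
    {f' : Y1 ⟶ Y2} {g' : Y2 ⟶ Y3} {h' : Y3 ⟶ Y1⟦(1 : ℤ)⟧}
    (hT : Triangle.mk f g h ∈ distTriang C) (hT' : Triangle.mk f' g' h' ∈ distTriang C)
    (a : X1 ⟶ Y1) (b : X2 ⟶ Y2) (w : f ≫ b = a ≫ f') :
    ∃ c : X3 ⟶ Y3, g ≫ c = b ≫ g' ∧ h ≫ a⟦(1 : ℤ)⟧' = c ≫ h' :=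
  complete_distinguished_triangle_morphism _ _ hT hT' a b w

section
variable {n : ℕ} {D : Set C}

lemma EV_biprod_left {A B V : C} (hA : EV n A V) (hB : EV n B V) : EV n (A ⊞ B) V := by
  intro k h1 h2 f
  apply biprod.hom_ext' <;> rw [comp_zero]
  · exact hA k h1 h2 _
  · exact hB k h1 h2 _

lemma EV_biprod_right {A B V : C} (hA : EV n V A) (hB : EV n V B) : EV n V (A ⊞ B) := by
  intro k h1 h2 f
  have h1' := hA k h1 h2 (f ≫ (biprod.fst : A ⊞ B ⟶ A)⟦(k : ℤ)⟧')
  have h2' := hB k h1 h2 (f ≫ (biprod.snd : A ⊞ B ⟶ B)⟦(k : ℤ)⟧')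
  have : f = f ≫ (𝟙 (A ⊞ B))⟦(k : ℤ)⟧' := by simp
  rw [this, ← biprod.total, Functor.map_add, Preadditive.comp_add, Functor.map_comp,
    Functor.map_comp, ← assoc, ← assoc, h1', h2']
  simp

end

section
variable {n : ℕ} {D : Set C}

lemma raZ {T dT T' M d B : C} {fT : T ⟶ dT} {gT : dT ⟶ T'} {hT : T' ⟶ T⟦(1 : ℤ)⟧}
    {f : M ⟶ d} {g : d ⟶ B} {h : B ⟶ M⟦(1 : ℤ)⟧}
    (t : MT_s11 n D fT gT hT) (t0 : MT_s11 n D f g h) (p : B ⟶ T') :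
    ∃ q : M ⟶ T, ∀ (M1 d1 B1 : C) (f1 : M1 ⟶ d1) (g1 : d1 ⟶ B1) (h1 : B1 ⟶ M1⟦(1 : ℤ)⟧),
      MT_s11 n D f1 g1 h1 → (∀ c : B1 ⟶ T', ∃ c' : B1 ⟶ B, c' ≫ p = c) →
      ∀ u : M1 ⟶ T, ∃ (v : M1 ⟶ M) (w : d1 ⟶ T), u = v ≫ q + f1 ≫ w := by
  obtain ⟨b, hb⟩ := t.ra d t0.hd (g ≫ p)
  obtain ⟨q, -, hq⟩ := cm1 t0.hT t.hT b p hb.symm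
  refine ⟨q, ?_⟩
  intro M1 d1 B1 f1 g1 h1 t1 hc u
  obtain ⟨b1, hb1⟩ := t1.la dT t.hd (u ≫ fT)
  obtain ⟨c, -, hc2⟩ := cm3 t1.hT t.hT u b1 hb1
  obtain ⟨c', rfl⟩ := hc c
  obtain ⟨b', hb'⟩ := t0.ra d1 t1.hd (g1 ≫ c')
  obtain ⟨v, -, hv⟩ := cm1 t1.hT t0.hT b' c' hb'.symm
  obtain ⟨w, hw⟩ := yo1 t1.hT (u - v ≫ q) (by
    rw [Functor.map_sub, Preadditive.comp_sub, hc2, Functor.map_comp, ← assoc h1, hv, assoc, assoc,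
      hq, sub_self])
  exact ⟨v, w, by rw [← hw]; abel⟩

lemma laZ {T dT T' M d B : C} {fT : T ⟶ dT} {gT : dT ⟶ T'} {hT : T' ⟶ T⟦(1 : ℤ)⟧}
    {f : M ⟶ d} {g : d ⟶ B} {h : B ⟶ M⟦(1 : ℤ)⟧}
    (t : MT_s11 n D fT gT hT) (t0 : MT_s11 n D f g h) (p : T' ⟶ B) :
    ∃ q : T ⟶ M, ∀ (M1 d1 B1 : C) (f1 : M1 ⟶ d1) (g1 : d1 ⟶ B1) (h1 : B1 ⟶ M1⟦(1 : ℤ)⟧),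
      MT_s11 n D f1 g1 h1 → (∀ c : T' ⟶ B1, ∃ c' : B ⟶ B1, p ≫ c' = c) →
      ∀ u : T ⟶ M1, ∃ (v : M ⟶ M1) (w : dT ⟶ M1), u = q ≫ v + fT ≫ w := by
  obtain ⟨b, hb⟩ := t0.ra dT t.hd (gT ≫ p)
  obtain ⟨q, -, hq⟩ := cm1 t.hT t0.hT b p hb.symm
  refine ⟨q, ?_⟩
  intro M1 d1 B1 f1 g1 h1 t1 hc u
  obtain ⟨b1, hb1⟩ := t.la d1 t1.hd (u ≫ f1)
  obtain ⟨c, -, hc2⟩ := cm3 t.hT t1.hT u b1 hb1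
  obtain ⟨c', rfl⟩ := hc c
  obtain ⟨b', hb'⟩ := t1.ra d t0.hd (g ≫ c')
  obtain ⟨v, -, hv⟩ := cm1 t0.hT t1.hT b' c' hb'.symm
  obtain ⟨w, hw⟩ := yo1 t.hT (u - q ≫ v) (by
    rw [Functor.map_sub, Preadditive.comp_sub, hc2, Functor.map_comp, ← assoc hT, hq, assoc, assoc,
      hv, sub_self])
  exact ⟨v, w, by rw [← hw]; abel⟩

lemma MT_s11.mem {S : Set C} {M d B : C} {f : M ⟶ d} {g : d ⟶ B} {h : B ⟶ M⟦(1 : ℤ)⟧}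
    (t : MT_s11 n D f g h) (hB : B ∈ S) : M ∈ backwardMut D S :=
  ⟨B, d, hB, t.hd, f, g, h, t.hT, t.hd, t.ra⟩

lemma D_sub_mut {S : Set C} (h0 : (0 : C) ∈ S) {d : C} (hd : d ∈ D) : d ∈ backwardMut D S :=
  ⟨0, d, h0, hd, 𝟙 d, 0, 0, contractible_distinguished d, hd,
    fun A' _ u => ⟨0, by rw [zero_comp]; exact ((isZero_zero C).eq_of_tgt _ _)⟩⟩

end

/-- the backward mutation of an `n`-cotorsion pair `(X, Y)` at a
functorially finite `D ⊆ I(X) = X ∩ Y` with `⋂ₖ {}^{⊥ₖ}D = ⋂ₖ D^{⊥ₖ}` is again an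
`n`-cotorsion pair, with core `I(μ_D(X)) = μ_D(I(X))`. -/
theorem stmt11 (n : ℕ) (hn : 1 ≤ n) (X Y D : Set C)
    (hXiso : ∀ ⦃A B : C⦄, (A ≅ B) → A ∈ X → B ∈ X)
    (hYiso : ∀ ⦃A B : C⦄, (A ≅ B) → A ∈ Y → B ∈ Y)
    (hXsum : ∀ A B : C, B ∈ X → ∀ (i : A ⟶ B) (r : B ⟶ A), i ≫ r = 𝟙 A → A ∈ X)
    (hYsum : ∀ A B : C, B ∈ Y → ∀ (i : A ⟶ B) (r : B ⟶ A), i ≫ r = 𝟙 A → A ∈ Y)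
    (hpair : NCotorsionPair n X Y)
    (hD : D ⊆ X ∩ Y)
    (hcontra : ContravariantlyFinite D) (hcov : CovariantlyFinite D)
    (hZ : leftPerpInter D n = rightPerpInter D n) :
    NCotorsionPair n (backwardMut D X) (backwardMut D Y) ∧
      backwardMut D X ∩ backwardMut D Y = backwardMut D (X ∩ Y) := by
  obtain ⟨hX, hY, hXc, hYc⟩ := hpair
  have memX : ∀ A : C, A ∈ X ↔ ∀ y ∈ Y, EV n A y := by
    intro A
    constructor
    · intro h y hy k h1 h2
      rw [hX] at h
      exact h k h1 h2 y hy
    · intro h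
      rw [hX]
      exact fun k h1 h2 y hy => h y hy k h1 h2
  have memY : ∀ A : C, A ∈ Y ↔ ∀ x ∈ X, EV n x A := by
    intro A
    constructor
    · intro h y hy k h1 h2
      rw [hY] at h
      exact h k h1 h2 y hy
    · intro h
      rw [hY]
      exact fun k h1 h2 y hy => h y hy k h1 h2
  have hXZ : ∀ A ∈ X, ∀ d ∈ D, EV n A d := fun A hA d hd => (memX A).1 hA d (hD hd).2
  have hYZ : ∀ A ∈ Y, ∀ d ∈ D, EV n A d := fun A hA =>
    (iff_lr hZ A).2 fun d hd => (memY A).1 hA d (hD hd).1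
  have hR : ∀ d ∈ D, ∀ d' ∈ D, EV n d d' := fun d hd => hXZ d (hD hd).1
  have h0X : (0 : C) ∈ X := (memX 0).2 fun y _ k _ _ f => (isZero_zero C).eq_of_src _ _
  have h0Y : (0 : C) ∈ Y := (memY 0).2 fun y _ k _ _ f =>
    ((shiftFunctor C (k : ℤ)).map_isZero (isZero_zero C)).eq_of_tgt _ _
  -- triangles
  have get : ∀ (S : Set C), (∀ A ∈ S, ∀ d ∈ D, EV n A d) → ∀ M ∈ backwardMut D S,
      ∃ (B d : C) (f : M ⟶ d) (g : d ⟶ B) (h : B ⟶ M⟦(1 : ℤ)⟧), B ∈ S ∧ MT_s11 n D f g h := by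
    rintro S hS M ⟨B, d, hB, hd, f, g, h, hT, -, ra⟩
    exact ⟨B, d, f, g, h, hB, MT_s11.of_right hn hZ hR hT hd ra (hS B hB)⟩
  have ofB : ∀ B : C, (∀ d ∈ D, EV n B d) →
      ∃ (M d : C) (f : M ⟶ d) (g : d ⟶ B) (h : B ⟶ M⟦(1 : ℤ)⟧), MT_s11 n D f g h := by
    intro B hB
    obtain ⟨d, g, hd, ra⟩ := hcontra B
    obtain ⟨M, f, h, hT⟩ := distinguished_cocone_triangle₁ g
    exact ⟨M, d, f, g, h, MT_s11.of_right hn hZ hR hT hd ra hB⟩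
  have ofM : ∀ M : C, (∀ d ∈ D, EV n M d) →
      ∃ (d B : C) (f : M ⟶ d) (g : d ⟶ B) (h : B ⟶ M⟦(1 : ℤ)⟧), MT_s11 n D f g h := by
    intro M hM
    obtain ⟨d, f, hd, la⟩ := hcov M
    obtain ⟨B, g, h, hT⟩ := distinguished_cocone_triangle f
    exact ⟨d, B, f, g, h, MT_s11.of_left hn hZ hR hT hd la hM⟩
  have memU : ∀ A : C, A ∈ backwardMut D X ↔ ∀ v ∈ backwardMut D Y, EV n A v := by
    intro A
    constructor
    · intro hA v hv
      obtain ⟨B, d, f, g, h, hB, t⟩ := get X hXZ A hA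
      obtain ⟨B', d', f', g', h', hB', t'⟩ := get Y hYZ v hv
      exact t.fwd t' ((memX B).1 hB B' hB')
    · intro hA
      obtain ⟨d, B, f, g, h, t⟩ := ofM A fun d hd => hA d (D_sub_mut h0Y hd)
      refine t.mem ((memX B).2 fun B' hB' => ?_)
      obtain ⟨M', d', f', g', h', t'⟩ := ofB B' (hYZ B' hB')
      exact t.bwd t' (hA M' (t'.mem hB'))
  have memV : ∀ A : C, A ∈ backwardMut D Y ↔ ∀ u ∈ backwardMut D X, EV n u A := by
    intro A
    constructor
    · intro hA u hu
      exact (memU u).1 hu A hA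
    · intro hA
      obtain ⟨d, B, f, g, h, t⟩ := ofM A
        ((iff_lr hZ A).2 fun d hd => hA d (D_sub_mut h0X hd))
      refine t.mem ((memY B).2 fun B' hB' => ?_)
      obtain ⟨M', d', f', g', h', t'⟩ := ofB B' (hXZ B' hB')
      exact t'.bwd t (hA M' (t'.mem hB'))
  refine ⟨⟨?_, ?_, ?_, ?_⟩, ?_⟩
  · ext A
    rw [memU]
    exact ⟨fun h k h1 h2 v hv => h v hv k h1 h2, fun h v hv k h1 h2 => h k h1 h2 v hv⟩
  · ext A
    rw [memV]
    exact ⟨fun h k h1 h2 v hv => h v hv k h1 h2, fun h v hv k h1 h2 => h k h1 h2 v hv⟩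
  · intro T0
    obtain ⟨T, r, hTZ, hr⟩ := contraZ hR hcov T0
    obtain ⟨dT, T', fT, gT, hT, t⟩ := ofM T hTZ
    obtain ⟨B, p, hB, hp⟩ := hXc T'
    obtain ⟨M, d, f, g, h, t0⟩ := ofB B (hXZ B hB)
    obtain ⟨q, hq⟩ := raZ t t0 p
    obtain ⟨e, s, he, hs⟩ := hcontra T
    refine ⟨M ⊞ e, biprod.desc q s ≫ r, ?_, ?_⟩
    · exact (memU _).2 fun v hv => EV_biprod_left ((memU M).1 (t0.mem hB) v hv)
        ((memU e).1 (D_sub_mut h0X he) v hv)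
    · intro M1 hM1 u
      obtain ⟨B1, d1, f1, g1, h1, hB1, t1⟩ := get X hXZ M1 hM1
      obtain ⟨u', rfl⟩ := hr M1 t1.Ml u
      obtain ⟨v, w, rfl⟩ := hq _ _ _ _ _ _ t1 (hp B1 hB1) u'
      obtain ⟨w', rfl⟩ := hs d1 t1.hd w
      refine ⟨biprod.lift v (f1 ≫ w'), ?_⟩
      rw [← assoc, biprod.lift_desc, assoc f1]
  · intro T0
    obtain ⟨T, r, hTZ, hr⟩ := covZ hR hcontra T0
    obtain ⟨dT, T', fT, gT, hT, t⟩ := ofM T ((iff_lr hZ T).2 hTZ)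
    obtain ⟨B, p, hB, hp⟩ := hYc T'
    obtain ⟨M, d, f, g, h, t0⟩ := ofB B (hYZ B hB)
    obtain ⟨q, hq⟩ := laZ t t0 p
    refine ⟨M ⊞ dT, r ≫ biprod.lift q fT, ?_, ?_⟩
    · exact (memV _).2 fun v hv => EV_biprod_right ((memV M).1 (t0.mem hB) v hv)
        ((memV dT).1 (D_sub_mut h0Y t.hd) v hv)
    · intro M1 hM1 u
      obtain ⟨B1, d1, f1, g1, h1, hB1, t1⟩ := get Y hYZ M1 hM1
      obtain ⟨u', rfl⟩ := hr M1 t1.Mr u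
      obtain ⟨v, w, rfl⟩ := hq _ _ _ _ _ _ t1 (hp B1 hB1) u'
      refine ⟨biprod.desc v w, ?_⟩
      rw [assoc, biprod.lift_desc]
  · ext M
    constructor
    · rintro ⟨hMX, hMY⟩
      obtain ⟨B, d, f, g, h, hB, t⟩ := get X hXZ M hMX
      refine t.mem ⟨hB, (memY B).2 fun B' hB' => ?_⟩
      obtain ⟨M', d', f', g', h', t'⟩ := ofB B' (hXZ B' hB')
      exact t'.bwd t ((memV M).1 hMY M' (t'.mem hB'))
    · rintro ⟨B, d, hB, rest⟩
      exact ⟨⟨B, d, hB.1, rest⟩, ⟨B, d, hB.2, rest⟩⟩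
end
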